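/- For every c > 0 and every nonnegative integer k there exist constants C > 0 and c₁ > 0 such that for all u₀ ∈ L¹(ℝⁿ; ℂᵐ) ∩ L²(ℝⁿ; ℂᵐ) with ∫_{ℝⁿ} |ξ|^{2k} |𝓕u₀(ξ)|² dξ < ∞, and all t ≥ 0: ∫_{ℝⁿ} |ξ|^{2k} e^{−c ρ(|ξ|) t} |𝓕u₀(ξ)|² dξ ≤ C (1+t)^{−n/2−k} ‖u₀‖²_{L¹} + C e^{−c₁ t} ∫_{ℝⁿ} |ξ|^{2k} |𝓕u₀(ξ)|² dξ. (By Plancherel's theorem, combined with the pointwise Fourier estimate |û(t,ξ)| ≤ C e^{−cρ(|ξ|)t}|𝓕u₀(ξ)|, this yields the decay estimate ‖∂ₓᵏu(t)‖_{L²} ≤ C(1+t)^{−n/4−k/2}‖u₀‖_{L¹} + C e^{−ct}‖∂ₓᵏu₀‖_{L²}.) -/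

import Mathlib

open Matrix BigOperators Finset

noncomputable section

/-- Complexification of a real matrix. -/
def cmap {a b : ℕ} (X : Matrix (Fin a) (Fin b) ℝ) : Matrix (Fin a) (Fin b) ℂ :=
  X.map (fun x => (x : ℂ))

/-- Real part of the standard Hermitian inner product `⟨x, y⟩ = ∑ xᵢ conj yᵢ` on `ℂᵐ`. -/
def reIP {m : ℕ} (x y : Fin m → ℂ) : ℝ := (∑ i, x i * (starRingEnd ℂ) (y i)).re

/-- Symmetric part `X₁ = (X + Xᵀ)/2` of a real square matrix. -/
def symP {m : ℕ} (X : Matrix (Fin m) (Fin m) ℝ) : Matrix (Fin m) (Fin m) ℝ :=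
  (2⁻¹ : ℝ) • (X + Xᵀ)

/-- Skew-symmetric part `X₂ = (X − Xᵀ)/2` of a real square matrix. -/
def skewP {m : ℕ} (X : Matrix (Fin m) (Fin m) ℝ) : Matrix (Fin m) (Fin m) ℝ :=
  (2⁻¹ : ℝ) • (X - Xᵀ)

/-- Kernel of (the complexification of) a real matrix, as a subset of `ℂᵐ`. -/
def kerC {m : ℕ} (L : Matrix (Fin m) (Fin m) ℝ) : Set (Fin m → ℂ) :=
  {z | (cmap L).mulVec z = 0}

/-- Euclidean norm on `ℂᵐ`. -/
def cnrm {m : ℕ} (z : Fin m → ℂ) : ℝ := Real.sqrt (∑ i, Complex.normSq (z i))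

open MeasureTheory

/-- The Fourier transform `𝓕u₀(ξ) = ∫ e^{−i x·ξ} u₀(x) dx` of `u₀ : ℝⁿ → ℂᵐ`. -/
def FT {n m : ℕ} (u₀ : (Fin n → ℝ) → (Fin m → ℂ)) (ξ : Fin n → ℝ) : Fin m → ℂ :=
  ∫ x : Fin n → ℝ, Complex.exp (-(Complex.I * (∑ j, (x j : ℂ) * (ξ j : ℂ)))) • u₀ x

/-- The Euclidean norm `cnrm` is the norm of `EuclideanSpace`. -/
lemma cnrm_eq_norm_toLp {m : ℕ} (z : Fin m → ℂ) :
    cnrm z = ‖(EuclideanSpace.equiv (Fin m) ℂ).symm z‖ := by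
  rw [EuclideanSpace.norm_eq, cnrm]
  simp [Complex.normSq_eq_norm_sq]

/-- The Fourier transform is bounded by the `L¹` norm. -/
lemma cnrm_FT_le {n m : ℕ} (u₀ : (Fin n → ℝ) → (Fin m → ℂ)) (ξ : Fin n → ℝ) :
    cnrm (FT u₀ ξ) ≤ ∫ x : Fin n → ℝ, cnrm (u₀ x) := by
  rw [cnrm_eq_norm_toLp, FT, ← ContinuousLinearEquiv.integral_comp_comm]
  refine (norm_integral_le_integral_norm _).trans_eq ?_
  congr 1
  funext x
  have hexp : ‖Complex.exp (-(Complex.I * (∑ j, (x j : ℂ) * (ξ j : ℂ))))‖ = 1 := by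
    rw [Complex.norm_exp]
    have hre : (-(Complex.I * (∑ j, (x j : ℂ) * (ξ j : ℂ)))).re = 0 := by
      have hsum : (∑ j, (x j : ℂ) * (ξ j : ℂ)) = ((∑ j, x j * ξ j : ℝ) : ℂ) := by
        push_cast
        rfl
      rw [hsum]
      simp
    rw [hre, Real.exp_zero]
  rw [map_smul, norm_smul, hexp, one_mul, cnrm_eq_norm_toLp]

lemma sum_normSq_FT_le {n m : ℕ} (u₀ : (Fin n → ℝ) → (Fin m → ℂ)) (ξ : Fin n → ℝ) :
    ∑ i, Complex.normSq (FT u₀ ξ i) ≤ (∫ x : Fin n → ℝ, cnrm (u₀ x)) ^ 2 := by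
  have hsq : ∑ i, Complex.normSq (FT u₀ ξ i) = cnrm (FT u₀ ξ) ^ 2 :=
    (Real.sq_sqrt (Finset.sum_nonneg fun i _ => Complex.normSq_nonneg _)).symm
  rw [hsq]
  exact pow_le_pow_left₀ (Real.sqrt_nonneg _) (cnrm_FT_le u₀ ξ) 2

lemma exp_neg_mul_sum_sq {n : ℕ} (b : ℝ) (ξ : Fin n → ℝ) :
    Real.exp (-(b * ∑ j, ξ j ^ 2)) = ∏ j, Real.exp (-b * ξ j ^ 2) := by
  rw [← Real.exp_sum, ← Finset.mul_sum, neg_mul]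

lemma integrable_exp_neg_mul_sum_sq (n : ℕ) {b : ℝ} (hb : 0 < b) :
    Integrable fun ξ : Fin n → ℝ => Real.exp (-(b * ∑ j, ξ j ^ 2)) := by
  simp only [exp_neg_mul_sum_sq]
  exact Integrable.fintype_prod (f := fun (_ : Fin n) (x : ℝ) => Real.exp (-b * x ^ 2))
    fun _ => integrable_exp_neg_mul_sq hb

lemma integral_exp_neg_mul_sum_sq (n : ℕ) (b : ℝ) :
    ∫ ξ : Fin n → ℝ, Real.exp (-(b * ∑ j, ξ j ^ 2)) = √(Real.pi / b) ^ n := by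
  simp only [exp_neg_mul_sum_sq]
  rw [integral_fintype_prod_volume_eq_prod (fun (_ : Fin n) (x : ℝ) => Real.exp (-b * x ^ 2))]
  simp only [integral_gaussian, Finset.prod_const, Finset.card_univ, Fintype.card_fin]

/-- A power times a Gaussian factor is dominated by a slower Gaussian factor. -/
lemma pow_mul_exp_neg_le (k : ℕ) {b s : ℝ} (hb : 0 < b) (hs : 0 ≤ s) :
    s ^ k * Real.exp (-(2 * b * s)) ≤ k.factorial / b ^ k * Real.exp (-(b * s)) := by
  have h := Real.pow_div_factorial_le_exp (b * s) (by positivity) k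
  rw [div_le_iff₀ (by positivity), mul_pow] at h
  have hexp : Real.exp (-(2 * b * s)) = Real.exp (-(b * s)) * Real.exp (-(b * s)) := by
    rw [← Real.exp_add]
    ring_nf
  have hinv : Real.exp (b * s) * Real.exp (-(b * s)) = 1 := by
    rw [← Real.exp_add, add_neg_cancel, Real.exp_zero]
  have hsk : s ^ k ≤ k.factorial / b ^ k * Real.exp (b * s) := by
    rw [div_mul_eq_mul_div, le_div_iff₀ (by positivity)]
    linarith
  calc s ^ k * Real.exp (-(2 * b * s))
      ≤ k.factorial / b ^ k * Real.exp (b * s) * Real.exp (-(2 * b * s)) := by gcongr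
    _ = k.factorial / b ^ k * Real.exp (-(b * s))
          * (Real.exp (b * s) * Real.exp (-(b * s))) := by rw [hexp]; ring
    _ = _ := by rw [hinv, mul_one]

/-- The dissipation factor splits into a low-frequency and a high-frequency part. -/
lemma exp_neg_dissipation_le {c s t : ℝ} (hc : 0 < c) (hs : 0 ≤ s) (ht : 0 ≤ t) :
    Real.exp (-(c * (s / (1 + s)) * t))
      ≤ Real.exp (c / 2) * Real.exp (-(2 * (c / 4 * (1 + t)) * s))
        + Real.exp (-(c / 2 * t)) := by
  have hct : 0 ≤ c * t := by positivity
  rcases le_total s 1 with h | h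
  · refine le_add_of_le_of_nonneg ?_ (Real.exp_pos _).le
    rw [← Real.exp_add, Real.exp_le_exp]
    have hρ : s / 2 ≤ s / (1 + s) := div_le_div_of_nonneg_left hs (by positivity) (by linarith)
    nlinarith [mul_le_mul_of_nonneg_left hρ hct, mul_le_mul_of_nonneg_left h hc.le]
  · refine le_add_of_nonneg_of_le (by positivity) ?_
    rw [Real.exp_le_exp]
    have hρ : 1 / 2 ≤ s / (1 + s) := by
      rw [div_le_div_iff₀ (by positivity) (by positivity)]
      linarith
    nlinarith [mul_le_mul_of_nonneg_left hρ hct]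

lemma sqrt_pow_mul_div_pow_eq (n k : ℕ) {a τ : ℝ} (ha : 0 < a) (hτ : 0 < τ) :
    k.factorial / (a * τ) ^ k * √(Real.pi / (a * τ)) ^ n
      = k.factorial / a ^ k * √(Real.pi / a) ^ n * τ ^ (-(n : ℝ) / 2 - k) := by
  have hpow : τ ^ (-(n : ℝ) / 2 - k) = (√τ ^ n)⁻¹ * (τ ^ k)⁻¹ := by
    rw [Real.rpow_sub hτ, Real.rpow_natCast, neg_div, Real.rpow_neg hτ.le, Real.sqrt_eq_rpow,
      ← Real.rpow_mul_natCast hτ.le, div_eq_mul_inv]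
    ring_nf
  rw [hpow, ← div_div, Real.sqrt_div (by positivity) τ, mul_pow, div_pow]
  have : √τ ≠ 0 := (Real.sqrt_pos.2 hτ).ne'
  field_simp

/-- **Decay estimate of the standard type (proof of (1.7) from (1.6) via Plancherel).**
For every `c > 0` and integer `k ≥ 0` there are `C, c₁ > 0` such that for all
`u₀ ∈ L¹ ∩ L²` with `∫ |ξ|^{2k}|𝓕u₀(ξ)|² dξ < ∞` and all `t ≥ 0`,
`∫ |ξ|^{2k} e^{−cρ(|ξ|)t}|𝓕u₀(ξ)|² dξ ≤ C(1+t)^{−n/2−k}‖u₀‖²_{L¹}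
  + C e^{−c₁ t} ∫ |ξ|^{2k}|𝓕u₀(ξ)|² dξ`, where `ρ(r) = r²/(1+r²)`. -/
theorem frequency_integral_estimate_standard
    (n m : ℕ) (hn : 1 ≤ n) (hm : 1 ≤ m)
    (c : ℝ) (hc : 0 < c) (k : ℕ) :
    ∃ C > (0:ℝ), ∃ c₁ > (0:ℝ),
      ∀ u₀ : (Fin n → ℝ) → (Fin m → ℂ),
        Integrable u₀ →
        MemLp u₀ 2 volume →
        Integrable (fun ξ : Fin n → ℝ =>
          (∑ j, ξ j ^ 2) ^ k * (∑ i, Complex.normSq (FT u₀ ξ i))) →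
        ∀ t : ℝ, 0 ≤ t →
          (∫ ξ : Fin n → ℝ,
              (∑ j, ξ j ^ 2) ^ k
                * Real.exp (-(c * ((∑ j, ξ j ^ 2) / (1 + ∑ j, ξ j ^ 2)) * t))
                * (∑ i, Complex.normSq (FT u₀ ξ i)))
            ≤ C * (1 + t) ^ (-(n : ℝ) / 2 - k) * (∫ x : Fin n → ℝ, cnrm (u₀ x)) ^ 2
              + C * Real.exp (-(c₁ * t))
                * ∫ ξ : Fin n → ℝ,
                    (∑ j, ξ j ^ 2) ^ k * (∑ i, Complex.normSq (FT u₀ ξ i)) := by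
  set K : ℝ := Real.exp (c / 2) * (k.factorial / (c / 4) ^ k * √(Real.pi / (c / 4)) ^ n) with hK
  have hK0 : 0 ≤ K := by positivity
  refine ⟨K + 1, by positivity, c / 2, by positivity, ?_⟩
  intro u₀ _ _ hint t ht
  set N : ℝ := ∫ x : Fin n → ℝ, cnrm (u₀ x)
  set J : ℝ := ∫ ξ : Fin n → ℝ, (∑ j, ξ j ^ 2) ^ k * (∑ i, Complex.normSq (FT u₀ ξ i)) with hJ
  have hb : 0 < c / 4 * (1 + t) := by positivity
  have hF0 : ∀ ξ, 0 ≤ ∑ i, Complex.normSq (FT u₀ ξ i) := fun ξ =>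
    Finset.sum_nonneg fun i _ => Complex.normSq_nonneg _
  have hs0 : ∀ ξ : Fin n → ℝ, 0 ≤ ∑ j, ξ j ^ 2 := fun ξ =>
    Finset.sum_nonneg fun j _ => sq_nonneg _
  have hJ0 : 0 ≤ J := integral_nonneg fun ξ => mul_nonneg (pow_nonneg (hs0 ξ) k) (hF0 ξ)
  set A : ℝ := Real.exp (c / 2) * (k.factorial / (c / 4 * (1 + t)) ^ k) * N ^ 2 with hA
  set E : ℝ := Real.exp (-(c / 2 * t)) with hE
  have hpoint : ∀ ξ : Fin n → ℝ,
      (∑ j, ξ j ^ 2) ^ k * Real.exp (-(c * ((∑ j, ξ j ^ 2) / (1 + ∑ j, ξ j ^ 2)) * t))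
          * (∑ i, Complex.normSq (FT u₀ ξ i))
        ≤ A * Real.exp (-(c / 4 * (1 + t) * ∑ j, ξ j ^ 2))
          + E * ((∑ j, ξ j ^ 2) ^ k * (∑ i, Complex.normSq (FT u₀ ξ i))) := by
    intro ξ
    have hFN := sum_normSq_FT_le u₀ ξ
    have hF := hF0 ξ
    have hs := hs0 ξ
    generalize (∑ i, Complex.normSq (FT u₀ ξ i)) = F at hFN hF ⊢
    generalize (∑ j, ξ j ^ 2) = s at hs ⊢
    calc s ^ k * Real.exp (-(c * (s / (1 + s)) * t)) * F
        ≤ s ^ k * (Real.exp (c / 2) * Real.exp (-(2 * (c / 4 * (1 + t)) * s)) + E) * F := by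
          gcongr
          exact exp_neg_dissipation_le hc hs ht
      _ = Real.exp (c / 2) * (s ^ k * Real.exp (-(2 * (c / 4 * (1 + t)) * s))) * F
            + E * (s ^ k * F) := by ring
      _ ≤ Real.exp (c / 2) * (k.factorial / (c / 4 * (1 + t)) ^ k
              * Real.exp (-(c / 4 * (1 + t) * s))) * N ^ 2 + E * (s ^ k * F) := by
          have hpow := pow_mul_exp_neg_le k hb hs
          exact add_le_add_left (mul_le_mul (mul_le_mul_of_nonneg_left hpow (Real.exp_pos _).le)
            hFN hF (by positivity)) _
      _ = _ := by rw [hA]; ring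
  have hgauss := (integrable_exp_neg_mul_sum_sq n hb).const_mul A
  have hdata := hint.const_mul E
  refine (integral_mono_of_nonneg (ae_of_all _ fun ξ => mul_nonneg
    (mul_nonneg (pow_nonneg (hs0 ξ) k) (Real.exp_pos _).le) (hF0 ξ))
    (hgauss.add hdata) (ae_of_all _ hpoint)).trans ?_
  simp only [Pi.add_apply]
  rw [integral_add hgauss hdata, integral_const_mul, integral_const_mul,
    integral_exp_neg_mul_sum_sq, ← hJ]
  have hτ : 0 ≤ (1 + t) ^ (-(n : ℝ) / 2 - k) := by positivity
  have hlow : A * √(Real.pi / (c / 4 * (1 + t))) ^ n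
      = K * (1 + t) ^ (-(n : ℝ) / 2 - k) * N ^ 2 := by
    have h := sqrt_pow_mul_div_pow_eq n k (a := c / 4) (τ := 1 + t) (by positivity) (by positivity)
    calc A * √(Real.pi / (c / 4 * (1 + t))) ^ n
        = Real.exp (c / 2) * (k.factorial / (c / 4 * (1 + t)) ^ k
            * √(Real.pi / (c / 4 * (1 + t))) ^ n) * N ^ 2 := by rw [hA]; ring
      _ = _ := by rw [h, hK]; ring
  rw [hlow]
  have hE0 : 0 ≤ E := (Real.exp_pos _).le
  refine add_le_add ?_ ?_
  · gcongr
    linarith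
  · gcongr
    exact le_mul_of_one_le_left hE0 (by linarith)
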